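/- Largest pre-composition class: A partial function F :⊆ ℕ^ℕ → ℕ^ℕ is computable relative to the halting problem 0' if and only if F ∘ G is limit computable for every limit computable G :⊆ ℕ^ℕ → ℕ^ℕ. -/

import Mathlib

open scoped Classical

namespace LimitComp

/-- Baire space `ℕ^ℕ`. -/
abbrev Baire : Type := ℕ → ℕ

/-- The finite prefix of length `k` of a point of Baire space. -/
def pre (p : Baire) (k : ℕ) : List ℕ := List.ofFn fun i : Fin k => p i

/-- Interleaving pairing `⟨q,p⟩(2n) = q(n)`, `⟨q,p⟩(2n+1) = p(n)`. -/
def pairB (q p : Baire) : Baire := fun n => if n % 2 = 0 then q (n / 2) else p (n / 2)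

/-- The `i`-th component of a tupling `⟨p₀,p₁,p₂,...⟩`. -/
def seqOf (p : Baire) (i : ℕ) : Baire := fun n => p (Nat.pair i n)

/-- Tupling `⟨p₀,p₁,p₂,...⟩` of a sequence of points of Baire space. -/
def tup (ps : ℕ → Baire) : Baire := fun m => ps m.unpair.1 m.unpair.2

/-- The limit map `lim :⊆ ℕ^ℕ → ℕ^ℕ`; it maps `⟨p₀,p₁,p₂,...⟩` to its pointwise
limit, which is defined whenever every coordinate is eventually constant. -/
noncomputable def limB : Baire →. Baire := fun p =>
  ⟨∀ n, ∃ i₀, ∀ i, i₀ ≤ i → seqOf p i n = seqOf p i₀ n,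
   fun h n => seqOf p (Classical.choose (h n)) n⟩

/-- Monotonicity of a finite approximation function under prefix extension
(this corresponds to a one-way output tape). -/
def PrefixMono (η : List ℕ → ℕ → Option ℕ) : Prop :=
  ∀ u v n y, u <+: v → η u n = some y → η v n = some y

/-- `η` approximates the partial function `F`: for every input in the domain of `F`
every output position is eventually filled with the correct output value. -/
def OneWayApprox (η : List ℕ → ℕ → Option ℕ) (F : Baire →. Baire) : Prop :=
  ∀ p q, q ∈ F p → ∀ n, ∃ k, η (pre p k) n = some (q n)

/-- Computability for partial functions on Baire space: `F` is computed by a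
Turing machine with one-way output tape, formalized via a computable monotone
finite approximation function. -/
def ComputableFn (F : Baire →. Baire) : Prop :=
  ∃ η : List ℕ → ℕ → Option ℕ, Computable₂ η ∧ PrefixMono η ∧ OneWayApprox η F

/-- `η` is a limit approximation of `F`: on every input in the domain of `F`,
every output cell eventually stabilizes to the correct output value. -/
def LimitApprox (η : List ℕ → ℕ → ℕ) (F : Baire →. Baire) : Prop :=
  ∀ p q, q ∈ F p → ∀ n, ∃ k₀, ∀ k, k₀ ≤ k → η (pre p k) n = q n

/-- Limit computability for partial functions on Baire space: `F` is computed by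
a Turing machine with a two-way output tape such that on inputs in the domain
every output cell eventually stabilizes. -/
def LimitComputableFn (F : Baire →. Baire) : Prop :=
  ∃ η : List ℕ → ℕ → ℕ, Computable₂ η ∧ LimitApprox η F

/-- The `i`-th Turing machine halts on input `p ∈ ℕ^ℕ` (i.e. it halts after
having read some finite prefix of `p`). -/
def haltsOn (i : ℕ) (p : Baire) : Prop :=
  ∃ k, ((Denumerable.ofNat Nat.Partrec.Code i).eval (Encodable.encode (pre p k))).Dom

/-- The Turing jump operator `J : ℕ^ℕ → ℕ^ℕ`. -/
noncomputable def jump (p : Baire) : Baire := fun i => if haltsOn i p then 1 else 0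

/-- The halting problem `0'`. -/
noncomputable def zero' : Baire := jump fun _ => 0

/-- `F` is computable relative to the oracle `q`. -/
def ComputableRel (q : Baire) (F : Baire →. Baire) : Prop :=
  ∃ G : Baire →. Baire, ComputableFn G ∧ ∀ p r, r ∈ F p → r ∈ G (pairB q p)

/-- `F` is limit computable relative to the oracle `q`. -/
def LimitComputableRel (q : Baire) (F : Baire →. Baire) : Prop :=
  ∃ G : Baire →. Baire, LimitComputableFn G ∧ ∀ p r, r ∈ F p → r ∈ G (pairB q p)

/-- Turing reducibility for points of Baire space. -/
def TuringLe (p q : Baire) : Prop :=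
  ∃ F : Baire →. Baire, ComputableFn F ∧ p ∈ F q

end LimitComp

namespace LimitComp

open Computable

section Search

variable {α σ : Type*}

/-- The first value among `A 0, …, A (m - 1)`, if there is one. -/
def firstHit (A : ℕ → Option σ) (m : ℕ) : Option σ :=
  Nat.rec none (fun j o => o.or (A j)) m

theorem firstHit_succ (A : ℕ → Option σ) (m : ℕ) :
    firstHit A (m + 1) = (firstHit A m).or (A m) := rfl

theorem exists_of_firstHit {A : ℕ → Option σ} {m : ℕ} {y : σ} (h : firstHit A m = some y) :
    ∃ j < m, A j = some y := by
  induction m with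
  | zero => simp [firstHit] at h
  | succ m ih =>
    rw [firstHit_succ, Option.or_eq_some_iff] at h
    rcases h with h | ⟨-, h⟩
    · obtain ⟨j, hj, hA⟩ := ih h
      exact ⟨j, hj.trans m.lt_succ_self, hA⟩
    · exact ⟨m, m.lt_succ_self, h⟩

theorem firstHit_mono {A : ℕ → Option σ} {m m' : ℕ} {y : σ} (hm : m ≤ m')
    (h : firstHit A m = some y) : firstHit A m' = some y := by
  induction m', hm using Nat.le_induction with
  | base => exact h
  | succ k _ ih => rw [firstHit_succ, ih, Option.some_or]

theorem exists_firstHit {A : ℕ → Option σ} {j m : ℕ} {y : σ} (hj : j < m) (h : A j = some y) :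
    ∃ y', firstHit A m = some y' := by
  have : ∃ y', firstHit A (j + 1) = some y' := by
    rw [firstHit_succ, h]
    cases firstHit A j <;> simp
  obtain ⟨y', hy'⟩ := this
  exact ⟨y', firstHit_mono hj hy'⟩

theorem firstHit_congr {A B : ℕ → Option σ} {m : ℕ} (h : ∀ j < m, A j = B j) :
    firstHit A m = firstHit B m := by
  induction m with
  | zero => rfl
  | succ m ih =>
    rw [firstHit_succ, firstHit_succ, ih fun j hj => h j (hj.trans m.lt_succ_self),
      h m m.lt_succ_self]

variable [Primcodable α] [Primcodable σ]

theorem computable_firstHit {A : α → ℕ → Option σ} (hA : Computable₂ A) {f : α → ℕ}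
    (hf : Computable f) : Computable fun a => firstHit (A a) (f a) := by
  have hor : Computable₂ (Option.or : Option σ → Option σ → Option σ) :=
    (Primrec.option_orElse.to_comp : Computable₂ _).of_eq fun ⟨a, b⟩ => by cases a <;> simp
  exact nat_rec hf (const none)
    (hor.comp (snd.comp snd) (hA.comp fst (fst.comp snd))).to₂

theorem computable_map_range {g : α → ℕ → σ} (hg : Computable₂ g) {f : α → ℕ}
    (hf : Computable f) : Computable fun a => (List.range (f a)).map (g a) := by
  refine (nat_rec (g := fun _ => ([] : List σ)) hf (const [])
    (h := fun a p => p.2 ++ [g a p.1])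
    (list_concat.comp (snd.comp snd) (hg.comp fst (fst.comp snd))).to₂).of_eq fun a => ?_
  induction f a with
  | zero => rfl
  | succ m ih => simp only [List.range_succ, List.map_append, List.map_cons, List.map_nil, ← ih]

end Search

section Prefixes

theorem pre_eq_map (p : Baire) (k : ℕ) : pre p k = (List.range k).map p := by
  apply List.ext_getElem <;> simp [pre]

theorem length_pre (p : Baire) (k : ℕ) : (pre p k).length = k := by simp [pre]

theorem pre_congr {p q : Baire} {k : ℕ} (h : ∀ m < k, p m = q m) : pre p k = pre q k := by
  simp only [pre_eq_map]
  exact List.map_congr_left fun m hm => h m (List.mem_range.1 hm)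

theorem pre_add (p : Baire) (s m : ℕ) :
    pre p (s + m) = pre p s ++ (List.range m).map fun i => p (s + i) := by
  simp [pre_eq_map, List.range_add, Function.comp_def]

theorem pre_isPrefix (p : Baire) {k k' : ℕ} (h : k ≤ k') : pre p k <+: pre p k' := by
  obtain ⟨d, rfl⟩ := Nat.exists_eq_add_of_le h
  exact ⟨_, (pre_add p k d).symm⟩

theorem getD_pre (p : Baire) {m k : ℕ} (h : m < k) : (pre p k).getD m 0 = p m := by
  simp [pre, h]

theorem getD_eq_of_isPrefix {u v : List ℕ} (h : u <+: v) {m : ℕ} (hm : m < u.length) :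
    u.getD m 0 = v.getD m 0 := by
  obtain ⟨w, rfl⟩ := h
  exact (List.getD_append _ _ _ _ hm).symm

theorem pre_getD_self (u : List ℕ) : pre (fun m => u.getD m 0) u.length = u := by
  apply List.ext_getElem <;> simp +contextual [pre]

end Prefixes

theorem OneWayApprox.eq_of_some {η : List ℕ → ℕ → Option ℕ} {F : Baire →. Baire}
    (hmono : PrefixMono η) (hη : OneWayApprox η F) {p q : Baire} (hq : q ∈ F p) {n k y : ℕ}
    (hy : η (pre p k) n = some y) : y = q n := by
  obtain ⟨k', hk'⟩ := hη p q hq n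
  rcases le_total k k' with h | h
  · have := hmono _ _ _ _ (pre_isPrefix p h) hy
    simpa [hk'] using this.symm
  · have := hmono _ _ _ _ (pre_isPrefix p h) hk'
    simpa [hy] using this

section ZeroJump

open Nat.Partrec (Code)

/-- The approximation of the halting problem at stage `k`. -/
def zeroApprox (k i : ℕ) : ℕ :=
  if ∃ j < k, (Code.evaln k (Denumerable.ofNat Code i)
    (Encodable.encode ((List.range j).map fun _ => 0))).isSome then 1 else 0

theorem computable_zeroApprox : Computable₂ zeroApprox := by
  have hR : PrimrecRel fun (j : ℕ) (a : ℕ × ℕ) => ((Code.evaln a.1 (Denumerable.ofNat Code a.2)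
      (Encodable.encode ((List.range j).map fun _ => 0))).isSome : Prop) := by
    refine Primrec.primrecPred ?_
    refine (Primrec.option_isSome.comp (Code.primrec_evaln.comp (Primrec.pair (Primrec.pair
      (Primrec.fst.comp Primrec.snd) ((Primrec.ofNat Code).comp (Primrec.snd.comp Primrec.snd)))
      (Primrec.encode.comp (Primrec.list_map (Primrec.list_range.comp Primrec.fst)
        (Primrec₂.const 0)))))).of_eq fun a => by simp
  have hE : PrimrecPred fun a : ℕ × ℕ => ∃ j < a.1, (Code.evaln a.1 (Denumerable.ofNat Code a.2)
      (Encodable.encode ((List.range j).map fun _ => 0))).isSome :=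
    (hR.exists_mem_list.comp (Primrec.list_range.comp Primrec.fst) Primrec.id).of_eq
      fun a => by simp
  exact (Primrec.ite hE (Primrec.const 1) (Primrec.const 0)).to_comp

theorem haltsOn_zero_iff (i : ℕ) : haltsOn i (fun _ => 0) ↔
    ∃ k, ∃ j < k, (Code.evaln k (Denumerable.ofNat Code i)
      (Encodable.encode ((List.range j).map fun _ => 0))).isSome := by
  simp only [haltsOn, pre_eq_map]
  constructor
  · rintro ⟨j, h⟩
    obtain ⟨y, hy⟩ := Part.dom_iff_mem.1 h
    obtain ⟨k, hk⟩ := Code.evaln_complete.1 hy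
    refine ⟨max k (j + 1), j, by omega, ?_⟩
    exact Option.isSome_iff_exists.2 ⟨y, Code.evaln_mono (le_max_left _ _) hk⟩
  · rintro ⟨k, j, -, h⟩
    obtain ⟨y, hy⟩ := Option.isSome_iff_exists.1 h
    exact ⟨j, Part.dom_iff_mem.2 ⟨y, Code.evaln_sound hy⟩⟩

theorem zeroApprox_eventually (i : ℕ) : ∃ k₀, ∀ k, k₀ ≤ k → zeroApprox k i = zero' i := by
  by_cases h : haltsOn i (fun _ => 0)
  · obtain ⟨k₀, j, hj, hs⟩ := (haltsOn_zero_iff i).1 h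
    obtain ⟨y, hy⟩ := Option.isSome_iff_exists.1 hs
    refine ⟨k₀, fun k hk => ?_⟩
    rw [zeroApprox, if_pos, zero', jump, if_pos h]
    exact ⟨j, hj.trans_le hk, Option.isSome_iff_exists.2 ⟨y, Code.evaln_mono hk hy⟩⟩
  · refine ⟨0, fun k _ => ?_⟩
    rw [zeroApprox, if_neg, zero', jump, if_neg h]
    exact fun hk => h ((haltsOn_zero_iff i).2 ⟨k, hk⟩)

/-- The halting problem decides every property of the form `∃ m, P a m` with `P` computable. -/
theorem exists_zero'_index {α : Type*} [Denumerable α] {P : α → ℕ → Bool} (hP : Computable₂ P) :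
    ∃ idx : α → ℕ, Computable idx ∧ ∀ a, zero' (idx a) = 0 ↔ ∀ m, P a m = false := by
  have hf : Partrec fun x : ℕ =>
      Nat.rfind fun m => Part.some (P (Denumerable.ofNat α x.unpair.1) m) := by
    refine Partrec.rfind (p := fun (x m : ℕ) =>
      Part.some (P (Denumerable.ofNat α x.unpair.1) m)) ?_
    exact (hP.comp ((Computable.ofNat α).comp (fst.comp (unpair.comp fst))) snd).partrec
  obtain ⟨c, hc⟩ := Code.exists_code.1 (Partrec.nat_iff.1 hf)
  refine ⟨fun a => Encodable.encode (c.curry (Encodable.encode a)), ?_, fun a => ?_⟩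
  · exact Computable.encode.comp
      (Code.primrec₂_curry.to_comp.comp (const c) Computable.encode)
  · have : haltsOn (Encodable.encode (c.curry (Encodable.encode a))) (fun _ => 0) ↔
        ∃ m, P a m = true := by
      rw [haltsOn, Denumerable.ofNat_encode]
      simp only [Code.eval_curry, hc, Nat.unpair_pair, Denumerable.ofNat_encode, exists_const]
      refine Nat.rfind_dom.trans (exists_congr fun m => ?_)
      rw [Part.mem_some_iff, eq_comm]
      exact and_iff_left fun _ => trivial
    simp [zero', jump, this]

end ZeroJump

theorem pairB_two_mul (q p : Baire) (i : ℕ) : pairB q p (2 * i) = q i := by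
  simp [pairB]

theorem pairB_two_mul_add_one (q p : Baire) (i : ℕ) : pairB q p (2 * i + 1) = p i := by
  have h : (2 * i + 1) / 2 = i := by omega
  simp [pairB, h]

theorem computable_pairB {α : Type*} [Primcodable α] {f g : α → Baire} (hf : Computable₂ f)
    (hg : Computable₂ g) : Computable₂ fun a => pairB (f a) (g a) := by
  have hdiv : Computable fun b : α × ℕ => b.2 / 2 :=
    (Primrec.nat_div.comp Primrec.snd (Primrec.const 2)).to_comp
  have hmod : Computable fun b : α × ℕ => b.2 % 2 == 0 :=
    (Primrec.beq.comp (Primrec.nat_mod.comp Primrec.snd (Primrec.const 2))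
      (Primrec.const 0)).to_comp
  refine (cond hmod (hf.comp fst hdiv) (hg.comp fst hdiv)).of_eq fun b => ?_
  simp only [pairB, Bool.cond_eq_ite, beq_iff_eq]

theorem eventually_pre_eq {x : ℕ → Baire} {y : Baire}
    (h : ∀ m, ∃ k₀, ∀ k, k₀ ≤ k → x k m = y m) (J : ℕ) :
    ∃ k₀, ∀ k, k₀ ≤ k → ∀ m < J, x k m = y m := by
  choose k₀ hk₀ using h
  exact ⟨(Finset.range J).sup k₀, fun k hk m hm =>
    hk₀ m k ((Finset.le_sup (Finset.mem_range.2 hm)).trans hk)⟩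

/-- Post-composing a limit computable function with a function computable relative to the
halting problem yields a limit computable function. -/
theorem ComputableRel.limitComputableFn_comp {F G : Baire →. Baire}
    (hF : ComputableRel zero' F) (hG : LimitComputableFn G) : LimitComputableFn (F.comp G) := by
  obtain ⟨H, ⟨η, hηc, hmono, hη⟩, hHF⟩ := hF
  obtain ⟨γ, hγc, hγ⟩ := hG
  let x : List ℕ → Baire := fun u => pairB (zeroApprox u.length) (γ u)
  have hx : Computable₂ x :=
    computable_pairB (computable_zeroApprox.comp (list_length.comp fst) snd) hγc
  refine ⟨fun u n => (firstHit (fun j => η (pre (x u) j) n) u.length).getD 0, ?_, ?_⟩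
  · refine Computable.option_getD (computable_firstHit
      (A := fun (a : List ℕ × ℕ) j => η (pre (x a.1) j) a.2) ?_ (list_length.comp fst)) (const 0)
    simp only [pre_eq_map]
    exact hηc.comp (computable_map_range
      (g := fun a : (List ℕ × ℕ) × ℕ => x a.1.1) (hx.comp (fst.comp (fst.comp fst)) snd) snd)
      (snd.comp fst)
  · intro p r hr n
    obtain ⟨q, hq, hr⟩ := Part.mem_bind_iff.1 hr
    have hrH := hHF q r hr
    obtain ⟨j, hj⟩ := hη _ _ hrH n
    obtain ⟨y, hy⟩ := exists_firstHit (A := fun j => η (pre (pairB zero' q) j) n)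
      (Nat.lt_succ_self j) hj
    obtain ⟨i, -, hi⟩ := exists_of_firstHit hy
    have hyr : y = r n := hη.eq_of_some hmono hrH hi
    have hlim : ∀ m, ∃ k₀, ∀ k, k₀ ≤ k → x (pre p k) m = pairB zero' q m := by
      intro m
      simp only [x, pairB, length_pre]
      split_ifs
      · exact zeroApprox_eventually _
      · exact hγ p q hq _
    obtain ⟨k₀, hk₀⟩ := eventually_pre_eq hlim (j + 1)
    refine ⟨max k₀ (j + 1), fun k hk => ?_⟩
    have hk' := hk₀ k ((le_max_left _ _).trans hk)
    have : firstHit (fun j => η (pre (x (pre p k)) j) n) (j + 1) = some y := by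
      rw [← hy]
      refine firstHit_congr fun i hi => ?_
      rw [pre_congr fun m hm => hk' m (hm.trans hi)]
    beta_reduce
    rw [length_pre, firstHit_mono ((le_max_right _ _).trans hk) this, ← hyr, Option.getD_some]

section CodedLimit

/-- The name `p` has the coded limit `q`: the sequence of finite lists coded by `p` converges
to `q` coordinatewise. -/
def CodedLimit (p q : Baire) : Prop :=
  ∀ n, ∃ k₀, ∀ k, k₀ ≤ k → (Denumerable.ofNat (List ℕ) (p k)).getD n 0 = q n

/-- The partial function mapping a sequence of codes of finite lists to its limit. -/
noncomputable def codedLim : Baire →. Baire := fun p =>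
  ⟨∃ q, CodedLimit p q, fun h => Classical.choose h⟩

theorem CodedLimit.unique {p q q' : Baire} (h : CodedLimit p q) (h' : CodedLimit p q') :
    q = q' := by
  funext n
  obtain ⟨k, hk⟩ := h n
  obtain ⟨k', hk'⟩ := h' n
  rw [← hk _ (le_max_left k k'), hk' _ (le_max_right k k')]

theorem mem_codedLim {p q : Baire} : q ∈ codedLim p ↔ CodedLimit p q := by
  constructor
  · rintro ⟨h, rfl⟩
    exact Classical.choose_spec h
  · intro h
    exact ⟨⟨q, h⟩, (Classical.choose_spec (⟨q, h⟩ : ∃ q, CodedLimit p q)).unique h⟩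

theorem limitComputableFn_codedLim : LimitComputableFn codedLim := by
  refine ⟨fun u n => (Denumerable.ofNat (List ℕ) (u.getD (u.length - 1) 0)).getD n 0, ?_, ?_⟩
  · refine ((Primrec.list_getD 0).comp ((Primrec.ofNat (List ℕ)).comp
      ((Primrec.list_getD 0).comp Primrec.fst (Primrec.nat_sub.comp
        (Primrec.list_length.comp Primrec.fst) (Primrec.const 1)))) Primrec.snd).to_comp
  · intro p q hq n
    obtain ⟨k₀, hk₀⟩ := mem_codedLim.1 hq n
    refine ⟨k₀ + 1, fun k hk => ?_⟩
    beta_reduce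
    rw [length_pre, getD_pre p (by omega)]
    exact hk₀ _ (by omega)

/-- The codes of the lists in `ws`, each of them prefixed by `l`. -/
def blocks (l : List ℕ) (ws : List (List ℕ)) : List ℕ :=
  ws.map fun w => Encodable.encode (l ++ w)

theorem getD_of_mem_blocks {q : Baire} {s n c : ℕ} (hn : n < s) {ws : List (List ℕ)}
    (hc : c ∈ blocks (pre q s) ws) : (Denumerable.ofNat (List ℕ) c).getD n 0 = q n := by
  obtain ⟨w, -, rfl⟩ := List.mem_map.1 hc
  rw [Denumerable.ofNat_encode, List.getD_append _ _ _ _ (by rwa [length_pre]), getD_pre q hn]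

variable {η : List ℕ → ℕ → ℕ} {F : Baire →. Baire} {q r : Baire}

/-- If no admissible extension of `u` changes the approximation, then it is correct at `u`. -/
theorem eq_of_forall_blocks (hη : LimitApprox η (F.comp codedLim)) (hr : r ∈ F q) {u : List ℕ}
    {s n : ℕ} (h : ∀ ws, η (u ++ blocks (pre q s) ws) n = η u n) : η u n = r n := by
  let p : Baire := fun m =>
    if m < u.length then u.getD m 0 else Encodable.encode (pre q (s + (m - u.length)))
  have hp : CodedLimit p q := fun n =>
    ⟨u.length + n + 1, fun k hk => by
      simp only [p]
      rw [if_neg (by omega), Denumerable.ofNat_encode, getD_pre q (by omega)]⟩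
  have hpre : ∀ j, pre p (u.length + j) = u ++ blocks (pre q s)
      ((List.range j).map fun m => (List.range m).map fun i => q (s + i)) := by
    intro j
    rw [pre_add]
    congr 1
    · conv_rhs => rw [← pre_getD_self u]
      exact pre_congr fun m hm => if_pos hm
    · simp [blocks, p, Function.comp_def, pre_add]
  obtain ⟨k₀, hk₀⟩ := hη p r (Part.mem_bind_iff.2 ⟨q, mem_codedLim.2 hp, hr⟩) n
  rw [← hk₀ (u.length + k₀) (by omega), hpre, h]

/-- Some finite list has no admissible extension which changes the approximation. -/
theorem exists_forall_blocks (hη : LimitApprox η (F.comp codedLim)) (hr : r ∈ F q) (n : ℕ) :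
    ∃ u s, ∀ ws, η (u ++ blocks (pre q s) ws) n = η u n := by
  by_contra! hne
  choose ws hws using hne
  let U : ℕ → List ℕ := fun s => Nat.rec [] (fun s u => u ++ blocks (pre q s) (ws u s)) s
  have hU : ∀ s, U (s + 1) = U s ++ blocks (pre q s) (ws (U s) s) := fun _ => rfl
  have hchange : ∀ s, η (U (s + 1)) n ≠ η (U s) n := fun s => hU s ▸ hws (U s) s
  have hUext : ∀ s d, U s <+: U (s + d) := by
    intro s d
    induction d with
    | zero => exact List.prefix_rfl
    | succ d ih => exact ih.trans ⟨_, (hU (s + d)).symm⟩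
  have hlen : ∀ s, s ≤ (U s).length := by
    intro s
    induction s with
    | zero => exact Nat.zero_le _
    | succ s ih =>
      have hpos : 0 < (blocks (pre q s) (ws (U s) s)).length := by
        rw [List.length_pos_iff]
        intro h
        apply hchange s
        rw [hU, h, List.append_nil]
      rw [hU, List.length_append]
      omega
  let p : Baire := fun m => (U (m + 1)).getD m 0
  have hpU : ∀ s m, m < (U s).length → p m = (U s).getD m 0 := by
    intro s m hm
    rcases le_total s (m + 1) with h | h <;> obtain ⟨d, hd⟩ := Nat.exists_eq_add_of_le h
    · have := hUext s d
      rw [← hd] at this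
      exact (getD_eq_of_isPrefix this hm).symm
    · rw [hd]
      exact getD_eq_of_isPrefix (hUext (m + 1) d) (hlen (m + 1))
  have hpre : ∀ s, pre p (U s).length = U s := by
    intro s
    conv_rhs => rw [← pre_getD_self (U s)]
    exact pre_congr fun m hm => hpU s m hm
  have hentry : ∀ i d m, (U (i + 1)).length ≤ m → m < (U (i + 1 + d)).length →
      (Denumerable.ofNat (List ℕ) ((U (i + 1 + d)).getD m 0)).getD i 0 = q i := by
    intro i d m hm
    induction d with
    | zero => intro h; exact absurd h (not_lt.2 hm)
    | succ d ih =>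
      intro h
      rw [← add_assoc, hU] at h ⊢
      by_cases hlt : m < (U (i + 1 + d)).length
      · rw [List.getD_append _ _ _ _ hlt]
        exact ih hlt
      · rw [List.length_append] at h
        have hm' : m - (U (i + 1 + d)).length <
            (blocks (pre q (i + 1 + d)) (ws (U (i + 1 + d)) (i + 1 + d))).length := by omega
        rw [List.getD_append_right _ _ _ _ (not_lt.1 hlt), List.getD_eq_getElem _ _ hm']
        exact getD_of_mem_blocks (by omega : i < i + 1 + d) (List.getElem_mem _)
  have hp : CodedLimit p q := by
    refine fun i => ⟨(U (i + 1)).length, fun k hk => ?_⟩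
    have hk' : k < (U (i + 1 + k)).length := (by omega : k < i + 1 + k).trans_le (hlen _)
    rw [hpU _ _ hk']
    exact hentry i k k hk hk'
  obtain ⟨k₀, hk₀⟩ := hη p r (Part.mem_bind_iff.2 ⟨q, mem_codedLim.2 hp, hr⟩) n
  have h₀ := hk₀ _ (hlen k₀)
  have h₁ := hk₀ _ (k₀.le_succ.trans (hlen (k₀ + 1)))
  rw [hpre k₀] at h₀
  rw [hpre (k₀ + 1)] at h₁
  exact hchange k₀ (h₁.trans h₀.symm)

end CodedLimit

section Candidate

/-- The value of the approximation `η` at the list coded by the search stage `j`, provided that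
the oracle part of `x` confirms, at the position given by `idx`, that it is correct. -/
def candidate (η : List ℕ → ℕ → ℕ) (idx : List ℕ × List ℕ × ℕ → ℕ) (x : Baire) (n j : ℕ) :
    Option ℕ :=
  let a := Denumerable.ofNat (List ℕ × ℕ) j.unpair.1
  let i := idx (a.1, (List.range a.2).map fun t => x (2 * t + 1), n)
  bif decide (2 * a.2 ≤ j) && (decide (2 * i ≤ j) && x (2 * i) == 0) then some (η a.1 n) else none

variable {η : List ℕ → ℕ → ℕ} {idx : List ℕ × List ℕ × ℕ → ℕ}

theorem computable_candidate (hη : Computable₂ η) (hidx : Computable idx) :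
    Computable₂ fun (a : List ℕ × ℕ) j => candidate η idx (fun t => a.1.getD t 0) a.2 j := by
  have hle : Computable₂ fun a b : ℕ => decide (2 * a ≤ b) :=
    (Primrec.nat_le.decide.comp (Primrec.nat_mul.comp (Primrec.const 2) Primrec.fst)
      Primrec.snd).to_comp
  have hmul : Computable fun a : ℕ => 2 * a :=
    (Primrec.nat_mul.comp (Primrec.const 2) Primrec.id).to_comp
  have hgetD : Computable₂ fun (l : List ℕ) t => l.getD t 0 := (Primrec.list_getD 0).to_comp
  have ha : Computable fun b : (List ℕ × ℕ) × ℕ =>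
      Denumerable.ofNat (List ℕ × ℕ) b.2.unpair.1 :=
    (Computable.ofNat _).comp (fst.comp (unpair.comp snd))
  have hl : Computable fun b : (List ℕ × ℕ) × ℕ =>
      (List.range (Denumerable.ofNat (List ℕ × ℕ) b.2.unpair.1).2).map
        fun t => b.1.1.getD (2 * t + 1) 0 :=
    computable_map_range (g := fun (b : (List ℕ × ℕ) × ℕ) t => b.1.1.getD (2 * t + 1) 0)
      (hgetD.comp (fst.comp (fst.comp fst)) (succ.comp (hmul.comp snd))) (snd.comp ha)
  have hi := hidx.comp ((fst.comp ha).pair (hl.pair (snd.comp fst)))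
  exact cond (Primrec.and.to_comp.comp (hle.comp (snd.comp ha) snd)
    (Primrec.and.to_comp.comp (hle.comp hi snd)
      (Primrec.beq.to_comp.comp (hgetD.comp (fst.comp fst) (hmul.comp hi)) (const 0))))
    (option_some.comp (hη.comp (fst.comp ha) (snd.comp fst))) (const none)

theorem candidate_congr {x y : Baire} {n j : ℕ} (h : ∀ m ≤ j, x m = y m) :
    candidate η idx x n j = candidate η idx y n j := by
  simp only [candidate]
  by_cases hs : 2 * (Denumerable.ofNat (List ℕ × ℕ) j.unpair.1).2 ≤ j
  · have hl : (List.range (Denumerable.ofNat (List ℕ × ℕ) j.unpair.1).2).map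
        (fun t => x (2 * t + 1)) = (List.range (Denumerable.ofNat (List ℕ × ℕ) j.unpair.1).2).map
        fun t => y (2 * t + 1) :=
      List.map_congr_left fun t ht => h _ (by have := List.mem_range.1 ht; omega)
    rw [hl]
    generalize idx _ = i
    by_cases hi : 2 * i ≤ j
    · rw [h _ hi]
    · simp [hi]
  · simp only [hs, decide_false, Bool.false_and, cond_false]

theorem candidate_pairB {q : Baire} {n j : ℕ} :
    candidate η idx (pairB zero' q) n j =
      let a := Denumerable.ofNat (List ℕ × ℕ) j.unpair.1
      let i := idx (a.1, pre q a.2, n)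
      bif decide (2 * a.2 ≤ j) && (decide (2 * i ≤ j) && zero' i == 0)
      then some (η a.1 n) else none := by
  simp only [candidate, pairB_two_mul, pairB_two_mul_add_one, pre_eq_map]

end Candidate

theorem ComputableRel.of_limitComputableFn_comp_codedLim {F : Baire →. Baire}
    (hF : LimitComputableFn (F.comp codedLim)) : ComputableRel zero' F := by
  obtain ⟨η, hηc, hη⟩ := hF
  obtain ⟨idx, hidx, hspec⟩ := exists_zero'_index (α := List ℕ × List ℕ × ℕ)
    (P := fun a m => !(η (a.1 ++ blocks a.2.1 (Denumerable.ofNat (List (List ℕ)) m)) a.2.2 ==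
      η a.1 a.2.2)) (by
    have hblocks : Computable₂ blocks :=
      (Primrec.list_map Primrec.snd (Primrec.encode.comp (Primrec.list_append.comp
        (Primrec.fst.comp Primrec.fst) Primrec.snd)).to₂).to_comp
    exact Primrec.not.to_comp.comp (Primrec.beq.to_comp.comp
      (hηc.comp (list_append.comp (fst.comp fst) (hblocks.comp (fst.comp (snd.comp fst))
        ((Computable.ofNat _).comp snd))) (snd.comp (snd.comp fst)))
      (hηc.comp (fst.comp fst) (snd.comp (snd.comp fst)))))
  have hconf : ∀ u l n, zero' (idx (u, l, n)) = 0 ↔ ∀ ws, η (u ++ blocks l ws) n = η u n := by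
    intro u l n
    rw [hspec]
    simp only [Bool.not_eq_false', beq_iff_eq]
    exact ⟨fun h ws => by simpa using h (Encodable.encode ws), fun h m => h _⟩
  let odd : Baire → Baire := fun x t => x (2 * t + 1)
  have hodd : ∀ q, odd (pairB zero' q) = q := fun q =>
    funext fun t => pairB_two_mul_add_one zero' q t
  let G : Baire →. Baire := fun x => Part.assert (x = pairB zero' (odd x)) fun _ => F (odd x)
  refine ⟨G, ⟨fun w n => firstHit (candidate η idx (fun t => w.getD t 0) n) w.length,
    computable_firstHit (computable_candidate hηc hidx) (list_length.comp fst), ?_, ?_⟩, ?_⟩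
  · intro u v n y huv hy
    refine firstHit_mono huv.length_le (hy ▸ firstHit_congr fun j hj => candidate_congr ?_)
    exact fun m hm => (getD_eq_of_isPrefix huv (hm.trans_lt hj)).symm
  · intro x r hr n
    obtain ⟨hx, hrq⟩ := Part.mem_assert_iff.1 hr
    clear hr
    generalize odd x = q at hx hrq
    subst hx
    obtain ⟨u, s, hus⟩ := exists_forall_blocks hη hrq n
    set i := idx (u, pre q s, n) with hi
    set j := Nat.pair (Encodable.encode (u, s)) (2 * s + 2 * i) with hj
    have hj' : 2 * s + 2 * i ≤ j := Nat.right_le_pair _ _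
    have hcand : candidate η idx (pairB zero' q) n j = some (η u n) := by
      rw [candidate_pairB]
      simp only [hj, Nat.unpair_pair, Denumerable.ofNat_encode, ← hi]
      rw [← hj, (hconf u (pre q s) n).2 hus]
      simp [show 2 * s ≤ j by omega, show 2 * i ≤ j by omega]
    obtain ⟨y, hy⟩ := exists_firstHit j.lt_succ_self hcand
    refine ⟨j + 1, ?_⟩
    beta_reduce
    rw [length_pre, firstHit_congr (B := candidate η idx (pairB zero' q) n), hy]
    · obtain ⟨j', -, hj'⟩ := exists_of_firstHit hy
      rw [candidate_pairB] at hj'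
      simp only [Bool.cond_eq_ite, Option.ite_none_right_eq_some, Bool.and_eq_true, beq_iff_eq,
        Option.some.injEq] at hj'
      rw [← hj'.2]
      congr 1
      exact eq_of_forall_blocks hη hrq ((hconf _ _ _).1 hj'.1.2.2)
    · exact fun j' hj' => candidate_congr fun m hm => getD_pre _ (by omega)
  · intro q r hr
    exact Part.mem_assert_iff.2 ⟨by rw [hodd], by rwa [hodd]⟩

end LimitComp

namespace LimitComp

/-- **Largest pre-composition class.** A partial function `F :⊆ ℕ^ℕ → ℕ^ℕ` is
computable relative to the halting problem `0'` if and only if `F ∘ G` is limit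
computable for every limit computable `G :⊆ ℕ^ℕ → ℕ^ℕ`. -/
theorem largest_precomposition_class (F : Baire →. Baire) :
    ComputableRel zero' F ↔
      ∀ G : Baire →. Baire, LimitComputableFn G → LimitComputableFn (F.comp G) := by
  exact ⟨fun hF _ hG => hF.limitComputableFn_comp hG,
    fun h => .of_limitComputableFn_comp_codedLim (h codedLim limitComputableFn_codedLim)⟩

end LimitComp
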